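/- Let f, h, k ∈ F_q[x] with k(c) ∈ F_q \ {0} for every c ∈ F_q. Then P(x) = f(Tr_{q^n/q}(x)) + k(Tr_{q^n/q}(x))·L_h(x) is a permutation polynomial of F_{q^n} if and only if one of the following holds: (i) p divides n, gcd(h(x), x^n − 1) = 1, and k(x)·x is a permutation polynomial of F_q; (ii) p does not divide n, gcd(h(x), x^n − 1) = x − 1, and f is a permutation polynomial of F_q; (iii) p does not divide n, gcd(h(x), x^n − 1) = 1, and n·f(x) + h(1)·k(x)·x is a permutation polynomial of F_q. -/

import Mathlib

open Polynomial

/-- The linearized `q`-associate of `f ∈ 𝔽_q[x]`, evaluated on an extension field: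
`L_f(y) = Σ aᵢ y^(qⁱ)` where `q` is the cardinality of `Fq`. -/
noncomputable def Lq {Fq Fqn : Type*} [Field Fq] [Fintype Fq] [Field Fqn] [Algebra Fq Fqn]
    (f : Polynomial Fq) (y : Fqn) : Fqn :=
  f.sum fun i a => algebraMap Fq Fqn a * y ^ (Fintype.card Fq) ^ i

/-- `T_n[f](x) = Σ Tr(aᵢ) xⁱ ∈ 𝔽_q[x]` for `f = Σ aᵢ xⁱ ∈ 𝔽_{qⁿ}[x]`, where `Tr` is the
field trace from `𝔽_{qⁿ}` onto `𝔽_q`. -/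
noncomputable def Tn (Fq : Type*) {Fqn : Type*} [Field Fq] [Field Fqn] [Algebra Fq Fqn]
    (f : Polynomial Fqn) : Polynomial Fq :=
  f.sum fun i a => C (Algebra.trace Fq Fqn a) * X ^ i
open FiniteField in
theorem Lq_eq_aeval_frobenius {Fq Fqn : Type*} [Field Fq] [Fintype Fq] [Field Fqn]
    [Algebra Fq Fqn] (f : Fq[X]) (y : Fqn) :
    Lq f y = aeval (frobeniusAlgHom Fq Fqn).toLinearMap f y := by
  rw [aeval_eq_sum_range, Lq, sum_over_range _ (by simp), LinearMap.sum_apply]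
  refine Finset.sum_congr rfl fun i _ => ?_
  rw [LinearMap.smul_apply, Algebra.smul_def, Module.End.coe_pow, AlgHom.coe_toLinearMap,
    coe_frobeniusAlgHom, pow_iterate]

open FiniteField in
theorem algebraMap_trace_eq_Lq {Fq Fqn : Type*} [Field Fq] [Fintype Fq] [Field Fqn]
    [Finite Fqn] [Algebra Fq Fqn] (x : Fqn) :
    algebraMap Fq Fqn (Algebra.trace Fq Fqn x) =
      Lq (∑ i ∈ Finset.range (Module.finrank Fq Fqn), (X : Fq[X]) ^ i) x := by
  rw [Lq_eq_aeval_frobenius, algebraMap_trace_eq_sum_pow, map_sum, LinearMap.sum_apply]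
  refine Finset.sum_congr rfl fun i _ => ?_
  rw [map_pow, aeval_X, Module.End.coe_pow, AlgHom.coe_toLinearMap, coe_frobeniusAlgHom,
    pow_iterate, Nat.card_eq_fintype_card]

theorem trace_pow_card_pow {Fq Fqn : Type*} [Field Fq] [Fintype Fq] [Field Fqn]
    [Finite Fqn] [Algebra Fq Fqn] (x : Fqn) (i : ℕ) :
    Algebra.trace Fq Fqn (x ^ Fintype.card Fq ^ i) = Algebra.trace Fq Fqn x := by
  induction i with
  | zero => simp
  | succ i ih =>
    rw [pow_succ, pow_mul, ← ih]
    exact Algebra.trace_eq_of_algEquiv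
      (FiniteField.frobeniusAlgEquivOfAlgebraic Fq Fqn) (x ^ Fintype.card Fq ^ i)

theorem trace_Lq {Fq Fqn : Type*} [Field Fq] [Fintype Fq] [Field Fqn]
    [Finite Fqn] [Algebra Fq Fqn] (h : Fq[X]) (x : Fqn) :
    Algebra.trace Fq Fqn (Lq h x) = h.eval 1 * Algebra.trace Fq Fqn x := by
  rw [Lq, eval_eq_sum, Polynomial.sum, Polynomial.sum, map_sum, Finset.sum_mul]
  refine Finset.sum_congr rfl fun i _ => ?_
  rw [← Algebra.smul_def, map_smul, trace_pow_card_pow, one_pow, mul_one, smul_eq_mul]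

open FiniteField in
/-- `L_h` is injective on the kernel of the trace iff `h` is coprime to `1 + x + ⋯ + x^(n-1)`. -/
theorem Lq_ker_trace_trivial_iff {Fq Fqn : Type*} [Field Fq] [Fintype Fq] [DecidableEq Fq]
    [Field Fqn] [Finite Fqn] [Algebra Fq Fqn] (h : Fq[X]) :
    (∀ z : Fqn, Algebra.trace Fq Fqn z = 0 → Lq h z = 0 → z = 0) ↔
      IsCoprime h (∑ i ∈ Finset.range (Module.finrank Fq Fqn), (X : Fq[X]) ^ i) := by
  set M : Fq[X] := ∑ i ∈ Finset.range (Module.finrank Fq Fqn), (X : Fq[X]) ^ i with hM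
  set φ := (frobeniusAlgHom Fq Fqn).toLinearMap with hφ
  have htr (z : Fqn) : Algebra.trace Fq Fqn z = 0 ↔ aeval φ M z = 0 := by
    rw [← Lq_eq_aeval_frobenius, ← algebraMap_trace_eq_Lq,
      map_eq_zero (algebraMap Fq Fqn)]
  have hmin : minpoly Fq φ = M * (X - 1) := by
    rw [hφ, minpoly_frobeniusAlgHom, hM, geom_sum_mul]
  have hne : minpoly Fq φ ≠ 0 := minpoly.ne_zero (Algebra.IsIntegral.isIntegral φ)
  constructor
  · intro H
    rw [← gcd_isUnit_iff]
    obtain ⟨e, he⟩ := gcd_dvd_right h M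
    obtain ⟨h', hh'⟩ := gcd_dvd_left h M
    set d := gcd h M
    have hd (z : Fqn) (hz : aeval φ d z = 0) : z = 0 := by
      refine H z ((htr z).2 ?_) ?_
      · rw [he, mul_comm, map_mul, Module.End.mul_apply, hz, map_zero]
      · rw [Lq_eq_aeval_frobenius, hh', mul_comm, map_mul, Module.End.mul_apply, hz, map_zero]
    have hprod : minpoly Fq φ = d * (e * (X - 1)) := by rw [hmin, he, mul_assoc]
    have hc : aeval φ (e * (X - 1)) = 0 := by
      ext z
      apply hd
      rw [← Module.End.mul_apply, ← map_mul, ← hprod, minpoly.aeval, LinearMap.zero_apply]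
    have hdvd := minpoly.dvd Fq φ hc
    rw [hprod] at hdvd hne
    refine isUnit_of_dvd_one ((mul_dvd_mul_iff_right (right_ne_zero_of_mul hne)).1 ?_)
    rwa [one_mul]
  · rintro ⟨a, b, hab⟩ z hz hLz
    rw [htr] at hz
    rw [Lq_eq_aeval_frobenius] at hLz
    calc z = aeval φ (a * h + b * M) z := by rw [hab, map_one, Module.End.one_apply]
      _ = 0 := by
        rw [map_add, map_mul, map_mul, LinearMap.add_apply, Module.End.mul_apply,
          Module.End.mul_apply, hz, hLz, map_zero, map_zero, add_zero]

/-- `P` permutes iff `L_h` is injective on the kernel of the trace and the map `P` induces on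
trace values permutes the base field. -/
theorem bijective_iff_trace_ker_and_induced {Fq Fqn : Type*} [Field Fq] [Fintype Fq]
    [Field Fqn] [Finite Fqn] [Algebra Fq Fqn]
    (f h k : Fq[X]) (hk : ∀ c : Fq, k.eval c ≠ 0) :
    Function.Bijective (fun x : Fqn =>
        algebraMap Fq Fqn (f.eval (Algebra.trace Fq Fqn x)) +
          algebraMap Fq Fqn (k.eval (Algebra.trace Fq Fqn x)) * Lq h x) ↔
      (∀ z : Fqn, Algebra.trace Fq Fqn z = 0 → Lq h z = 0 → z = 0) ∧
        Function.Bijective fun c : Fq =>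
          (Module.finrank Fq Fqn : Fq) * f.eval c + h.eval 1 * k.eval c * c := by
  set P := fun x : Fqn => algebraMap Fq Fqn (f.eval (Algebra.trace Fq Fqn x)) +
    algebraMap Fq Fqn (k.eval (Algebra.trace Fq Fqn x)) * Lq h x with hP
  have htr (x : Fqn) : Algebra.trace Fq Fqn (P x) =
      (Module.finrank Fq Fqn : Fq) * f.eval (Algebra.trace Fq Fqn x) +
        h.eval 1 * k.eval (Algebra.trace Fq Fqn x) * Algebra.trace Fq Fqn x := by
    rw [hP, map_add, Algebra.trace_algebraMap, ← Algebra.smul_def, map_smul, trace_Lq,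
      nsmul_eq_mul, smul_eq_mul]
    ring
  constructor
  · refine fun hbij => ⟨fun z hz hLz => hbij.1 ?_, Finite.surjective_iff_bijective.1 fun c => ?_⟩
    · have h0 : Lq h (0 : Fqn) = 0 := by rw [Lq_eq_aeval_frobenius, map_zero]
      simp only [hP, hz, hLz, h0, map_zero]
    · obtain ⟨y, rfl⟩ := Algebra.trace_surjective Fq Fqn c
      obtain ⟨x, rfl⟩ := hbij.2 y
      exact ⟨_, (htr x).symm⟩
  · rintro ⟨hker, hbij⟩
    refine Finite.injective_iff_bijective.1 fun x y hxy => ?_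
    have ht : Algebra.trace Fq Fqn x = Algebra.trace Fq Fqn y := by
      apply hbij.1
      simp only [← htr, hxy]
    have hL : Lq h x = Lq h y := by
      simp only [hP, ht] at hxy
      exact mul_left_cancel₀ ((_root_.map_ne_zero _).2 (hk _)) (add_left_cancel hxy)
    refine sub_eq_zero.1 (hker _ ?_ ?_)
    · rw [map_sub, ht, sub_self]
    · rw [Lq_eq_aeval_frobenius, map_sub, ← Lq_eq_aeval_frobenius, ← Lq_eq_aeval_frobenius, hL,
        sub_self]

theorem isCoprime_X_sub_one_iff {K : Type*} [Field K] (h : K[X]) :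
    IsCoprime h (X - 1) ↔ h.eval 1 ≠ 0 := by
  have hirr : Irreducible (X - 1 : K[X]) := by simpa using irreducible_X_sub_C (1 : K)
  rw [isCoprime_comm, hirr.coprime_iff_not_dvd, ← C_1, dvd_iff_isRoot, IsRoot.def]

theorem gcd_X_pow_sub_one_eq_one_iff {K : Type*} [Field K] [DecidableEq K] (h : K[X]) (n : ℕ) :
    gcd h (X ^ n - 1) = 1 ↔
      IsCoprime h (∑ i ∈ Finset.range n, (X : K[X]) ^ i) ∧ h.eval 1 ≠ 0 := by
  rw [← isCoprime_X_sub_one_iff, ← IsCoprime.mul_right_iff, geom_sum_mul, ← gcd_isUnit_iff]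
  refine ⟨fun H => H.symm ▸ isUnit_one, fun H => ?_⟩
  rw [← normalize_gcd, normalize_eq_one.2 H]

theorem gcd_X_pow_sub_one_eq_X_sub_one_iff {K : Type*} [Field K] [DecidableEq K] (h : K[X])
    {n : ℕ} (hn : (n : K) ≠ 0) :
    gcd h (X ^ n - 1) = X - 1 ↔
      IsCoprime h (∑ i ∈ Finset.range n, (X : K[X]) ^ i) ∧ h.eval 1 = 0 := by
  have hcop : IsCoprime (X - 1) (∑ i ∈ Finset.range n, (X : K[X]) ^ i) := by
    rw [isCoprime_comm, isCoprime_X_sub_one_iff]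
    simpa [eval_finsetSum] using hn
  have hmonic : (X - 1 : K[X]).Monic := by simpa using monic_X_sub_C (1 : K)
  have hroot : h.eval 1 = 0 ↔ X - 1 ∣ h := by rw [← C_1, dvd_iff_isRoot, IsRoot.def]
  by_cases hdvd : X - 1 ∣ h
  · obtain ⟨g, rfl⟩ := hdvd
    rw [IsCoprime.mul_left_iff, and_iff_left (hroot.2 (dvd_mul_right _ _)), and_iff_right hcop,
      ← geom_sum_mul, mul_comm (X - 1) g, gcd_mul_right, hmonic.normalize_eq_self,
      mul_eq_right₀ hmonic.ne_zero, ← gcd_isUnit_iff]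
    refine ⟨fun H => H.symm ▸ isUnit_one, fun H => ?_⟩
    rw [← normalize_gcd, normalize_eq_one.2 H]
  · refine iff_of_false (fun H => hdvd (H ▸ gcd_dvd_left _ _)) fun H => hdvd (hroot.1 H.2)

theorem bijective_mul_left_comp_iff {K α : Type*} [Field K] {a : K} (ha : a ≠ 0) (g : α → K) :
    (Function.Bijective fun c => a * g c) ↔ Function.Bijective g :=
  (Equiv.mulLeft₀ a ha).comp_bijective g

/-- Let `f, h, k ∈ 𝔽_q[x]` with `k(c) ≠ 0` for all `c ∈ 𝔽_q`. Then
`P(x) = f(Tr(x)) + k(Tr(x))·L_h(x)` is a PP of `𝔽_{qⁿ}` iff one of the following holds: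
(i) `p ∣ n`, `gcd(h, xⁿ-1) = 1`, and `k(x)·x` is a PP of `𝔽_q`;
(ii) `p ∤ n`, `gcd(h, xⁿ-1) = x-1`, and `f` is a PP of `𝔽_q`;
(iii) `p ∤ n`, `gcd(h, xⁿ-1) = 1`, and `n·f(x) + h(1)·k(x)·x` is a PP of `𝔽_q`. -/
theorem trace_PP_iff_trichotomy {Fq Fqn : Type*} [Field Fq] [Fintype Fq] [DecidableEq Fq]
    [Field Fqn] [Algebra Fq Fqn]
    {n : ℕ} (hn : 0 < n) (hrank : Module.finrank Fq Fqn = n)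
    (f h k : Polynomial Fq) (hk : ∀ c : Fq, k.eval c ≠ 0) :
    Function.Bijective (fun x : Fqn =>
        algebraMap Fq Fqn (f.eval (Algebra.trace Fq Fqn x)) +
          algebraMap Fq Fqn (k.eval (Algebra.trace Fq Fqn x)) * Lq h x) ↔
      ((ringChar Fq ∣ n ∧ gcd h (X ^ n - 1 : Polynomial Fq) = 1 ∧
          Function.Bijective fun c : Fq => k.eval c * c) ∨
        (¬ ringChar Fq ∣ n ∧ gcd h (X ^ n - 1 : Polynomial Fq) = X - 1 ∧
          Function.Bijective fun c : Fq => f.eval c) ∨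
        (¬ ringChar Fq ∣ n ∧ gcd h (X ^ n - 1 : Polynomial Fq) = 1 ∧
          Function.Bijective fun c : Fq => (n : Fq) * f.eval c + h.eval 1 * k.eval c * c)) := by
  subst hrank
  have : FiniteDimensional Fq Fqn := Module.finite_of_finrank_pos hn
  have : Finite Fqn := Module.finite_of_finite Fq
  rw [bijective_iff_trace_ker_and_induced f h k hk, Lq_ker_trace_trivial_iff,
    gcd_X_pow_sub_one_eq_one_iff, ← ringChar.spec]
  set N : Fq := (Module.finrank Fq Fqn : Fq)
  by_cases hN : N = 0
  · by_cases h1 : h.eval 1 = 0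
    · have hconst : ¬ Function.Bijective fun _ : Fq => (0 : Fq) :=
        fun H => zero_ne_one (H.1 rfl : (0 : Fq) = 1)
      simp only [hN, h1, hconst, zero_mul, add_zero, ne_eq, not_true_eq_false, and_false, false_and,
        or_false]
    · simp only [hN, h1, mul_assoc, bijective_mul_left_comp_iff h1, zero_mul, zero_add, ne_eq,
        not_true_eq_false, not_false_eq_true, and_true, true_and, false_and, or_false]
  · rw [gcd_X_pow_sub_one_eq_X_sub_one_iff h hN]
    by_cases h1 : h.eval 1 = 0
    · simp only [hN, h1, bijective_mul_left_comp_iff hN, zero_mul, add_zero, ne_eq, not_true_eq_false,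
        not_false_eq_true, and_true, true_and, and_false, false_and, or_false, false_or]
    · simp [hN, h1]
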